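/- Fix r ∈ ℕ* and a real constant c > 0 such that η(C_m^r) ≤ c(m−1)+1 for every m ∈ ℕ*. Then for every finite abelian group G of rank r and exponent n, one has t(G) ≤ 2c(n−1) + 1. -/

import Mathlib

open Multiset Finset

/-- The cross number of a sequence (multiset) over an additive group:
    the sum of the reciprocals of the orders of its elements. -/
noncomputable def crossNum {G : Type*} [AddCommGroup G] (S : Multiset G) : ℝ :=
  (S.map fun g => (1 : ℝ) / (addOrderOf g : ℝ)).sum

/-- A tiny zero-sum sequence: non-empty, zero sum, cross number at most 1. -/
def IsTinyZS {G : Type*} [AddCommGroup G] (S' : Multiset G) : Prop :=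
  S' ≠ 0 ∧ S'.sum = 0 ∧ crossNum S' ≤ 1

/-- `tC G` : the smallest `t ≥ 1` such that every sequence over `G` of length `≥ t`
    contains a tiny zero-sum subsequence. -/
noncomputable def tC (G : Type*) [AddCommGroup G] : ℕ :=
  sInf {t : ℕ | 0 < t ∧ ∀ S : Multiset G, t ≤ Multiset.card S → ∃ S' ≤ S, IsTinyZS S'}

/-- `etaC G` : the smallest `t ≥ 1` such that every sequence over `G` of length `≥ t`
    contains a non-empty zero-sum subsequence of length at most `exp(G)`. -/
noncomputable def etaC (G : Type*) [AddCommGroup G] : ℕ :=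
  sInf {t : ℕ | 0 < t ∧ ∀ S : Multiset G, t ≤ Multiset.card S →
    ∃ S' ≤ S, S' ≠ 0 ∧ S'.sum = 0 ∧ Multiset.card S' ≤ AddMonoid.exponent G}

/-- `etaDD G d' d` : the smallest `t ≥ 1` such that every sequence over
    `G_d = {x : G | d • x = 0}` of length `≥ t` contains a non-empty subsequence of length
    at most `d'` whose sum lies in `G_{d/d'}`. -/
noncomputable def etaDD (G : Type*) [AddCommGroup G] (d' d : ℕ) : ℕ :=
  sInf {t : ℕ | 0 < t ∧ ∀ S : Multiset G, (∀ g ∈ S, d • g = 0) → t ≤ Multiset.card S →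
    ∃ S' ≤ S, S' ≠ 0 ∧ Multiset.card S' ≤ d' ∧ (d / d') • S'.sum = 0}

/-- `rhoC G` : the maximum of the cross numbers of sequences over `G` containing
    no tiny zero-sum subsequence. -/
noncomputable def rhoC (G : Type*) [AddCommGroup G] : ℝ :=
  sSup {x : ℝ | ∃ S : Multiset G, (¬ ∃ S' ≤ S, IsTinyZS S') ∧ crossNum S = x}

/-- `maxPF n = P⁺(n)`, the greatest prime divisor of `n`, with `P⁺(1) = 1`. -/
def maxPF (n : ℕ) : ℕ := if n = 1 then 1 else n.primeFactors.sup id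

/-- `G` is a finite abelian group of rank `r`, i.e. `G ≅ C_{n₁} ⊕ ⋯ ⊕ C_{n_r}` with
    `1 < n₁ ∣ ⋯ ∣ n_r`. -/
def HasRank (G : Type*) [AddCommGroup G] (r : ℕ) : Prop :=
  ∃ n : Fin r → ℕ, (∀ i, 1 < n i) ∧ (∀ i j : Fin r, i ≤ j → n i ∣ n j) ∧
    Nonempty (G ≃+ ((i : Fin r) → ZMod (n i)))

section DescentWeight

open Classical in
/-- The largest `k` with `d * k ∣ n` all of whose prime factors are at most every prime factor
of `d`. -/
noncomputable def descentWeight (n d : ℕ) : ℕ :=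
  (n.divisors.filter fun k => d * k ∣ n ∧
    ∀ p q : ℕ, p.Prime → q.Prime → p ∣ k → q ∣ d → p ≤ q).sup id

lemma le_descentWeight {n d k : ℕ} (hn : n ≠ 0) (hk : d * k ∣ n)
    (h : ∀ p q : ℕ, p.Prime → q.Prime → p ∣ k → q ∣ d → p ≤ q) : k ≤ descentWeight n d := by
  classical
  have : k ∈ n.divisors.filter fun k => d * k ∣ n ∧
      ∀ p q : ℕ, p.Prime → q.Prime → p ∣ k → q ∣ d → p ≤ q := by
    simp only [Finset.mem_filter, Nat.mem_divisors]
    exact ⟨⟨(Dvd.intro_left d rfl).trans hk, hn⟩, hk, h⟩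
  exact Finset.le_sup (f := id) this

lemma descentWeight_le {n d B : ℕ} (hB : ∀ k : ℕ, d * k ∣ n →
    (∀ p q : ℕ, p.Prime → q.Prime → p ∣ k → q ∣ d → p ≤ q) → k ≤ B) :
    descentWeight n d ≤ B := by
  refine Finset.sup_le fun k hk => ?_
  simp only [Finset.mem_filter] at hk
  exact hB k hk.2.1 hk.2.2

lemma one_le_descentWeight {n d : ℕ} (hn : n ≠ 0) (hd : d ∣ n) : 1 ≤ descentWeight n d :=
  le_descentWeight hn (by simpa using hd) fun p _ hp _ h _ =>
    absurd (Nat.dvd_one.1 h) hp.ne_one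

lemma descentWeight_anti {n d e : ℕ} (hn : n ≠ 0) (h : e ∣ d) :
    descentWeight n d ≤ descentWeight n e :=
  descentWeight_le fun _ hk hpq => le_descentWeight hn ((mul_dvd_mul_right h _).trans hk)
    fun p q hp hq hpk hqe => hpq p q hp hq hpk (hqe.trans h)

lemma minFac_mul_descentWeight_le {n d : ℕ} (hn : n ≠ 0) (hd : d ≠ 1) :
    d.minFac * descentWeight n d ≤ descentWeight n (d / d.minFac) := by
  have hp : d.minFac.Prime := Nat.minFac_prime hd
  rw [mul_comm, ← Nat.le_div_iff_mul_le hp.pos]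
  refine descentWeight_le fun k hk hpq => ?_
  rw [Nat.le_div_iff_mul_le hp.pos]
  have hdd : d / d.minFac * d.minFac = d := Nat.div_mul_cancel d.minFac_dvd
  refine le_descentWeight hn ?_ fun p q hpp hqp hpk hqd => ?_
  · rwa [mul_comm k, ← mul_assoc, hdd]
  · have hqd' : q ∣ d := hqd.trans (Nat.div_dvd_of_dvd d.minFac_dvd)
    rcases (hpp.dvd_mul).1 hpk with h | h
    · exact hpq p q hpp hqp h hqd'
    · rw [(Nat.prime_dvd_prime_iff_eq hpp hp).1 h]
      exact Nat.minFac_le_of_dvd hqp.two_le hqd'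

lemma descentWeight_prime_pow_mul_le {P a b m e : ℕ} (hP : P.Prime) (hm : m ≠ 0)
    (hlt : ∀ p : ℕ, p.Prime → p ∣ m → p < P) (he : e ∣ m) (he1 : e ≠ 1) :
    descentWeight (P ^ a * m) (P ^ b * e) ≤ descentWeight m e := by
  refine descentWeight_le fun k hk hpq => le_descentWeight hm ?_ fun p q hp hq hpk hqe =>
    hpq p q hp hq hpk (hqe.mul_left _)
  have hPk : ¬ P ∣ k := fun h => by
    have hq := Nat.minFac_prime he1
    have h1 := hpq P _ hP hq h ((Nat.minFac_dvd e).mul_left _)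
    exact absurd (hlt _ hq ((Nat.minFac_dvd e).trans he)) (not_lt.2 h1)
  have hPe : ¬ P ∣ e := fun h => (hlt P hP (h.trans he)).false
  have hcop : Nat.Coprime (e * k) (P ^ a) :=
    (((hP.coprime_iff_not_dvd).2 (hP.not_dvd_mul hPe hPk)).symm).pow_right a
  refine hcop.dvd_of_dvd_mul_left (Dvd.dvd.trans ?_ hk)
  exact ⟨P ^ b, by ring⟩

lemma descentWeight_prime_pow_le {P a b m : ℕ} (hP : P.Prime) (hm : m ≠ 0) (hb : b ≤ a) :
    descentWeight (P ^ a * m) (P ^ b) ≤ P ^ (a - b) * m := by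
  refine descentWeight_le fun k hk _ => Nat.le_of_dvd
    (Nat.mul_pos (pow_pos hP.pos _) (Nat.pos_of_ne_zero hm)) ?_
  rw [← Nat.sub_add_cancel hb, pow_add, mul_comm _ (P ^ b), mul_assoc] at hk
  exact Nat.dvd_of_mul_dvd_mul_left (pow_pos hP.pos _) (by simpa using hk)

lemma sum_prime_pow_descent (P : ℕ) (hP : 1 ≤ P) (a : ℕ) :
    ∑ b ∈ Finset.range a, (P - 1) * P ^ (a - (b + 1)) = P ^ a - 1 := by
  rw [← Finset.mul_sum]
  have h := Finset.sum_range_reflect (fun i => P ^ i) a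
  have h2 : ∑ b ∈ Finset.range a, P ^ (a - (b + 1)) = ∑ i ∈ Finset.range a, P ^ i := by
    rw [← h]
    exact Finset.sum_congr rfl fun i _ => by rw [Nat.sub_sub, add_comm 1 i]
  obtain ⟨Q, rfl⟩ := Nat.exists_eq_add_of_le' hP
  rw [h2, Nat.add_sub_cancel, mul_comm]
  have := geom_sum_mul_add Q a
  omega

lemma sum_minFac_descentWeight_prime_pow_mul_le {P a m : ℕ} (hP : P.Prime) (hm : m ≠ 0)
    (hlt : ∀ p : ℕ, p.Prime → p ∣ m → p < P) :
    ∑ d ∈ (P ^ a * m).divisors, (d.minFac - 1) * descentWeight (P ^ a * m) d ≤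
      (P ^ a - 1) * m + (a + 1) * ∑ d ∈ m.divisors, (d.minFac - 1) * descentWeight m d := by
  classical
  set F : ℕ → ℕ := fun d => (d.minFac - 1) * descentWeight (P ^ a * m) d with hF
  set g : ℕ → ℕ := fun d => (d.minFac - 1) * descentWeight m d
  have hsub : (P ^ a * m).divisors ⊆
      (Finset.range (a + 1) ×ˢ m.divisors).image (fun x => P ^ x.1 * x.2) := by
    intro d hd
    obtain ⟨x, e, hx, he, rfl⟩ := exists_dvd_and_dvd_of_dvd_mul (Nat.dvd_of_mem_divisors hd)
    obtain ⟨b, hb, rfl⟩ := (Nat.dvd_prime_pow hP).1 hx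
    exact Finset.mem_image.2 ⟨(b, e), Finset.mem_product.2
      ⟨Finset.mem_range_succ_iff.2 hb, Nat.mem_divisors.2 ⟨he, hm⟩⟩, rfl⟩
  have hpt : ∀ b ∈ Finset.range (a + 1), ∀ e ∈ m.divisors, e ≠ 1 → F (P ^ b * e) ≤ g e := by
    intro b _ e he he1
    have hem := Nat.dvd_of_mem_divisors he
    refine Nat.mul_le_mul (Nat.sub_le_sub_right ?_ 1)
      (descentWeight_prime_pow_mul_le hP hm hlt hem he1)
    exact Nat.minFac_le_of_dvd (Nat.minFac_prime he1).two_le ((Nat.minFac_dvd e).mul_left _)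
  have h1m : 1 ∈ m.divisors := Nat.one_mem_divisors.2 hm
  have hpow : ∑ b ∈ Finset.range (a + 1), F (P ^ b * 1) ≤ (P ^ a - 1) * m := by
    rw [Finset.sum_range_succ', ← sum_prime_pow_descent P hP.one_le a, Finset.sum_mul]
    simp only [mul_one, pow_zero]
    have : F 1 = 0 := by simp [hF]
    rw [this, add_zero]
    refine Finset.sum_le_sum fun b hb => ?_
    rw [mul_assoc]
    simp only [hF]
    rw [hP.pow_minFac (Nat.succ_ne_zero b)]
    exact Nat.mul_le_mul_left _
      (descentWeight_prime_pow_le hP hm (Nat.succ_le_of_lt (Finset.mem_range.1 hb)))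
  calc ∑ d ∈ (P ^ a * m).divisors, F d
      ≤ ∑ d ∈ (Finset.range (a + 1) ×ˢ m.divisors).image (fun x => P ^ x.1 * x.2), F d :=
        Finset.sum_le_sum_of_subset hsub
    _ ≤ ∑ x ∈ Finset.range (a + 1) ×ˢ m.divisors, F (P ^ x.1 * x.2) :=
        Finset.sum_image_le_of_nonneg fun _ _ => Nat.zero_le _
    _ = ∑ b ∈ Finset.range (a + 1), ∑ e ∈ m.divisors, F (P ^ b * e) := Finset.sum_product _ _ _
    _ ≤ ∑ b ∈ Finset.range (a + 1), (F (P ^ b * 1) + ∑ e ∈ m.divisors, g e) := by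
        refine Finset.sum_le_sum fun b hb => ?_
        rw [← Finset.add_sum_erase _ _ h1m]
        refine Nat.add_le_add_left ((Finset.sum_le_sum fun e he => ?_).trans
          (Finset.sum_le_sum_of_subset (Finset.erase_subset 1 _))) _
        exact hpt b hb e (Finset.mem_of_mem_erase he) (Finset.ne_of_mem_erase he)
    _ ≤ _ := by
        rw [Finset.sum_add_distrib, Finset.sum_const, Finset.card_range, smul_eq_mul]
        exact Nat.add_le_add_right hpow _

lemma sum_minFac_sub_one_mul_descentWeight_le (n : ℕ) (hn : 0 < n) :
    ∑ d ∈ n.divisors, (d.minFac - 1) * descentWeight n d ≤ 2 * (n - 1) := by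
  induction n using Nat.strong_induction_on with
  | _ n ih =>
  rcases eq_or_ne n 1 with rfl | hn1
  · simp
  have hne : n.primeFactors.Nonempty := Nat.nonempty_primeFactors.2 (by omega)
  set P := n.primeFactors.max' hne
  have hPmem : P ∈ n.primeFactors := Finset.max'_mem _ _
  have hP : P.Prime := Nat.prime_of_mem_primeFactors hPmem
  have hPn : P ∣ n := Nat.dvd_of_mem_primeFactors hPmem
  obtain ⟨a, m, hPm, hnm⟩ := Nat.exists_eq_pow_mul_and_not_dvd hn.ne' P hP.ne_one
  have ha : a ≠ 0 := by
    rintro rfl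
    simp only [pow_zero, one_mul] at hnm
    exact hPm (hnm ▸ hPn)
  have hm0 : m ≠ 0 := by rintro rfl; simp at hPm
  have hlt : ∀ p : ℕ, p.Prime → p ∣ m → p < P := by
    intro p hp hpm
    refine lt_of_le_of_ne (Finset.le_max' _ _ ?_) (by rintro rfl; exact hPm hpm)
    exact Nat.mem_primeFactors.2 ⟨hp, hnm ▸ hpm.mul_left _, hn.ne'⟩
  have hstep := sum_minFac_descentWeight_prime_pow_mul_le (a := a) hP hm0 hlt
  rw [← hnm] at hstep
  have hq1 : 1 < P ^ a := Nat.one_lt_pow ha hP.one_lt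
  have hm1 : 1 ≤ m := Nat.pos_of_ne_zero hm0
  have ihm := ih m (by rw [hnm]; exact lt_mul_of_one_lt_left hm1 hq1) hm1
  refine hstep.trans ?_
  set T := ∑ d ∈ m.divisors, (d.minFac - 1) * descentWeight m d
  clear_value T
  obtain ⟨q, hq⟩ := Nat.exists_eq_add_of_le' hq1.le
  obtain ⟨l, rfl⟩ := Nat.exists_eq_add_of_le' hm1
  rw [hnm, hq]
  simp only [Nat.add_sub_cancel] at ihm ⊢
  have hgoal : q * (l + 1) + (a + 1) * T ≤ 2 * ((q + 1) * (l + 1)) - 2 := by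
    rcases eq_or_ne l 0 with rfl | hl
    · have : T = 0 := by omega
      subst this
      omega
    · have hP3 : 3 ≤ P := by
        have h2 := Nat.minFac_prime (n := l + 1) (by omega)
        have := hlt _ h2 (Nat.minFac_dvd _)
        have := h2.two_le
        omega
      have hb : 1 + a * 2 ≤ q + 1 := by
        rw [← hq]
        have h3 : 1 + a * 2 ≤ 3 ^ a := by
          have := one_add_mul_le_pow (R := ℤ) (a := 2) (by norm_num) a
          zify
          simpa using this
        exact h3.trans (Nat.pow_le_pow_left hP3 a)
      have h1 : (a + 1) * T ≤ (a + 1) * (2 * l) := Nat.mul_le_mul_left _ ihm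
      have h2 : a * 2 * l ≤ q * l := Nat.mul_le_mul_right l (by omega)
      apply Nat.le_sub_of_add_le
      nlinarith
  omega

end DescentWeight

section ShortZeroSum

lemma etaC_spec {H : Type*} [AddCommGroup H] [Finite H] (U : Multiset H)
    (hU : etaC H ≤ Multiset.card U) :
    ∃ U' ≤ U, U' ≠ 0 ∧ U'.sum = 0 ∧ Multiset.card U' ≤ AddMonoid.exponent H := by
  classical
  cases nonempty_fintype H
  have hexp : 0 < AddMonoid.exponent H :=
    Nat.pos_of_ne_zero AddMonoid.exponent_ne_zero_of_finite
  have hne : {t : ℕ | 0 < t ∧ ∀ S : Multiset H, t ≤ Multiset.card S →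
    ∃ S' ≤ S, S' ≠ 0 ∧ S'.sum = 0 ∧ Multiset.card S' ≤ AddMonoid.exponent H}.Nonempty := by
    refine ⟨Fintype.card H * AddMonoid.exponent H, Nat.mul_pos Fintype.card_pos hexp,
      fun S hS => ?_⟩
    obtain ⟨x, -, hx⟩ : ∃ x ∈ (Finset.univ : Finset H), AddMonoid.exponent H ≤ S.count x := by
      refine Finset.exists_le_of_sum_le Finset.univ_nonempty ?_
      rw [Finset.sum_const, smul_eq_mul, Finset.card_univ, Multiset.sum_count_eq_card]
      · exact hS
      · simp
    refine ⟨Multiset.replicate (AddMonoid.exponent H) x, Multiset.le_count_iff_replicate_le.1 hx,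
      ?_, ?_, by simp⟩
    · rw [← Multiset.card_pos, Multiset.card_replicate]
      exact hexp
    · rw [Multiset.sum_replicate, AddMonoid.exponent_nsmul_eq_zero]
  exact (Nat.sInf_mem hne).2 U hU

lemma exists_le_map_eq {α β : Type*} (f : α → β) (s : Multiset α) :
    ∀ U ≤ s.map f, ∃ t ≤ s, t.map f = U := by
  classical
  induction s using Multiset.induction_on with
  | empty => exact fun U hU => ⟨0, le_rfl, by simpa using (Multiset.le_zero.1 hU).symm⟩
  | cons a s ih =>
    intro U hU
    rw [Multiset.map_cons] at hU
    by_cases h : f a ∈ U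
    · obtain ⟨t, hts, ht⟩ := ih (U.erase (f a)) (by simpa using Multiset.erase_le_erase (f a) hU)
      exact ⟨a ::ₘ t, Multiset.cons_le_cons a hts, by
        rw [Multiset.map_cons, ht, Multiset.cons_erase h]⟩
    · obtain ⟨t, hts, ht⟩ := ih U ((Multiset.le_cons_of_notMem h).1 hU)
      exact ⟨t, hts.trans (Multiset.le_cons_self s a), ht⟩

lemma HasRank.card_torsion_le {G : Type*} [AddCommGroup G] [Finite G] {r : ℕ} (hG : HasRank G r)
    {p : ℕ} (hp : 0 < p) : Nat.card (nsmulAddMonoidHom p : G →+ G).ker ≤ p ^ r := by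
  classical
  obtain ⟨k, hk1, -, ⟨e⟩⟩ := hG
  have : ∀ i, NeZero (k i) := fun i => ⟨by have := hk1 i; omega⟩
  let A : Fin r → Type := fun i => {x : ZMod (k i) // p • x = 0}
  let f : (nsmulAddMonoidHom p : G →+ G).ker → ∀ i, A i := fun x i =>
    ⟨e x i, by
      have hx : p • (x : G) = 0 := x.2
      have h : (p • e (x : G)) i = 0 := by rw [← _root_.map_nsmul, hx, _root_.map_zero, Pi.zero_apply]
      exact h⟩
  have hf : Function.Injective f := fun x y h => by
    refine Subtype.ext (e.injective (funext fun i => ?_))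
    exact congrArg Subtype.val (congrFun h i)
  calc Nat.card (nsmulAddMonoidHom p : G →+ G).ker ≤ Nat.card (∀ i, A i) :=
        Nat.card_le_card_of_injective f hf
    _ = ∏ i, Nat.card (A i) := Nat.card_pi
    _ ≤ ∏ _i : Fin r, p := by
        refine Finset.prod_le_prod' fun i _ => ?_
        have := IsAddCyclic.card_nsmul_eq_zero_le (α := ZMod (k i)) hp
        rwa [Nat.card_eq_fintype_card, Fintype.card_subtype]
    _ = p ^ r := by simp

lemma HasRank.exists_torsion_injective {G : Type*} [AddCommGroup G] [Finite G] {r : ℕ}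
    (hG : HasRank G r) {p : ℕ} (hp : p.Prime) :
    ∃ ψ : (nsmulAddMonoidHom p : G →+ G).ker →+ (Fin r → ZMod p), Function.Injective ψ := by
  have : Fact p.Prime := ⟨hp⟩
  set K := (nsmulAddMonoidHom p : G →+ G).ker
  let : Module (ZMod p) K := AddCommGroup.zmodModule (n := p) fun x => Subtype.ext x.2
  have hcard := hG.card_torsion_le hp.pos
  rw [Module.natCard_eq_pow_finrank (K := ZMod p), Nat.card_zmod] at hcard
  have hfin : Module.finrank (ZMod p) K ≤ Module.finrank (ZMod p) (Fin r → ZMod p) := by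
    rw [Module.finrank_fin_fun]
    exact (Nat.pow_le_pow_iff_right hp.one_lt).1 hcard
  obtain ⟨φ, hφ⟩ := finrank_le_iff_exists_linearMap.1 hfin
  exact ⟨φ.toAddMonoidHom, hφ⟩

/-- If `p ∣ d`, a sequence of `η(C_p ^ r)` elements killed by `d` has a non-empty subsequence of
length at most `p` whose sum is killed by `d / p`. -/
lemma HasRank.exists_short_sum_torsion {G : Type*} [AddCommGroup G] [Finite G] {r : ℕ}
    (hG : HasRank G r) {p d : ℕ} (hp : p.Prime) (hpd : p ∣ d) (S : Multiset G)
    (hS : ∀ g ∈ S, d • g = 0) (hcard : etaC (Fin r → ZMod p) ≤ Multiset.card S) :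
    ∃ T ≤ S, T ≠ 0 ∧ Multiset.card T ≤ p ∧ (d / p) • T.sum = 0 := by
  have : NeZero p := ⟨hp.ne_zero⟩
  obtain ⟨ψ, hψ⟩ := hG.exists_torsion_injective hp
  let K := (nsmulAddMonoidHom d : G →+ G).ker
  let μ : K →+ (nsmulAddMonoidHom p : G →+ G).ker :=
    ((nsmulAddMonoidHom (d / p) : G →+ G).comp K.subtype).codRestrict _ fun x => by
      have hx : d • (x : G) = 0 := x.2
      change p • (d / p) • (x : G) = 0
      rw [← mul_nsmul', Nat.mul_div_cancel' hpd, hx]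
  obtain ⟨S₀, rfl⟩ : ∃ S₀ : Multiset K, S₀.map Subtype.val = S :=
    CanLift.prf (cond := fun s : Multiset G => ∀ x ∈ s, x ∈ K) S hS
  obtain ⟨U, hU, hU0, hUs, hUc⟩ := etaC_spec (S₀.map (ψ.comp μ)) (by simpa using hcard)
  obtain ⟨T, hT, rfl⟩ := exists_le_map_eq _ _ U hU
  refine ⟨T.map Subtype.val, Multiset.map_le_map hT, ?_, ?_, ?_⟩
  · rwa [Ne, Multiset.map_eq_zero] at hU0 ⊢
  · rw [Multiset.card_map] at hUc ⊢
    refine hUc.trans (Nat.le_of_dvd hp.pos (AddMonoid.exponent_dvd_of_forall_nsmul_eq_zero ?_))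
    intro x
    ext i
    simp
  · rw [← map_multiset_sum] at hUs
    have h0 : μ T.sum = 0 := hψ (by simpa using hUs)
    have h1 : (d / p) • ((T.sum : K) : G) = 0 := congrArg Subtype.val h0
    rwa [← AddSubgroup.coe_subtype, map_multiset_sum] at h1

end ShortZeroSum

section Replacement

variable {G : Type*} [AddCommGroup G]

lemma crossNum_add (S T : Multiset G) : crossNum (S + T) = crossNum S + crossNum T := by
  simp [crossNum]

lemma crossNum_cons (g : G) (S : Multiset G) :
    crossNum (g ::ₘ S) = 1 / (addOrderOf g : ℝ) + crossNum S := by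
  simp [crossNum]

lemma crossNum_eq_of_forall_addOrderOf {T : Multiset G} {d : ℕ} (hT : ∀ g ∈ T, addOrderOf g = d) :
    crossNum T = Multiset.card T * (1 / (d : ℝ)) := by
  have : T.map (fun g => (1 : ℝ) / (addOrderOf g : ℝ)) = T.map fun _ => (1 : ℝ) / d :=
    Multiset.map_congr rfl fun g hg => by rw [hT g hg]
  rw [crossNum, this]
  simp

/-- Replacing a subsequence by its sum creates no tiny zero-sum subsequence, provided the cross
number does not decrease. -/
lemma exists_isTinyZS_of_replace {T R : Multiset G} (hT : T ≠ 0)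
    (hk : crossNum T ≤ 1 / (addOrderOf T.sum : ℝ))
    (h : ∃ U ≤ T.sum ::ₘ R, IsTinyZS U) : ∃ U ≤ T + R, IsTinyZS U := by
  classical
  obtain ⟨U, hU, hU0, hUs, hUk⟩ := h
  by_cases hmem : T.sum ∈ U
  · obtain ⟨V, rfl⟩ := Multiset.exists_cons_of_mem hmem
    rw [Multiset.sum_cons] at hUs
    rw [crossNum_cons] at hUk
    refine ⟨T + V, Multiset.add_le_add_left ((Multiset.cons_le_cons_iff _).1 hU), ?_, ?_, ?_⟩
    · simp [hT]
    · rw [Multiset.sum_add, hUs]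
    · rw [crossNum_add]
      linarith
  · exact ⟨U, ((Multiset.le_cons_of_notMem hmem).1 hU).trans (Multiset.le_add_left R T),
      hU0, hUs, hUk⟩

lemma zero_notMem_of_free {S : Multiset G} (h : ¬ ∃ U ≤ S, IsTinyZS U) : (0 : G) ∉ S :=
  fun h0 => h ⟨{0}, Multiset.singleton_le.2 h0, by simp, by simp, by simp [crossNum]⟩

/-- Repeatedly replacing at most `p = d.minFac` elements of order `d` by their sum, of order
dividing `d / p`, does not decrease the total weight and ends with fewer than `η(C_p ^ r)`
elements of each order `d`. -/
lemma sum_descentWeight_le_of_free [Finite G] {r : ℕ} {c : ℝ} (hG : HasRank G r)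
    (hc : ∀ m : ℕ, 0 < m → (etaC (Fin r → ZMod m) : ℝ) ≤ c * ((m : ℝ) - 1) + 1)
    {n : ℕ} (hn : AddMonoid.exponent G = n) (S : Multiset G) (hS : ¬ ∃ U ≤ S, IsTinyZS U) :
    (((S.map fun g => descentWeight n (addOrderOf g)).sum : ℕ) : ℝ) ≤
      c * ((∑ d ∈ n.divisors, (d.minFac - 1) * descentWeight n d : ℕ) : ℝ) := by
  classical
  have hn0 : n ≠ 0 := hn ▸ AddMonoid.exponent_ne_zero_of_finite
  induction hN : (S.map addOrderOf).sum using Nat.strong_induction_on generalizing S with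
  | _ N ih =>
  subst hN
  by_cases hex : ∃ d : ℕ, d ≠ 1 ∧ d ∣ n ∧
      etaC (Fin r → ZMod d.minFac) ≤ Multiset.card (S.filter fun g => d = addOrderOf g)
  · obtain ⟨d, hd1, hdn, hdc⟩ := hex
    have hp := Nat.minFac_prime hd1
    have hd0 : 0 < d := Nat.pos_of_dvd_of_pos hdn (Nat.pos_of_ne_zero hn0)
    obtain ⟨T, hTS, hT0, hTc, hTs⟩ := hG.exists_short_sum_torsion hp d.minFac_dvd
      (S.filter fun g => d = addOrderOf g)
      (fun g hg => by rw [(Multiset.mem_filter.1 hg).2]; exact addOrderOf_nsmul_eq_zero g) hdc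
    have hTd : ∀ g ∈ T, addOrderOf g = d := fun g hg =>
      (Multiset.mem_filter.1 (Multiset.mem_of_le hTS hg)).2.symm
    obtain ⟨R, rfl⟩ := Multiset.le_iff_exists_add.1 (hTS.trans (Multiset.filter_le _ _))
    have hsd : addOrderOf T.sum ∣ d / d.minFac := addOrderOf_dvd_of_nsmul_eq_zero hTs
    have hq0 : 0 < d / d.minFac := Nat.div_pos (Nat.minFac_le hd0) hp.pos
    have hsle : addOrderOf T.sum ≤ d / d.minFac := Nat.le_of_dvd hq0 hsd
    have hs0 : 0 < addOrderOf T.sum := addOrderOf_pos _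
    have hTpos : 1 ≤ Multiset.card T := Multiset.card_pos.2 hT0
    have hTmap {f : ℕ → ℕ} : (T.map fun g => f (addOrderOf g)).sum = Multiset.card T * f d := by
      rw [Multiset.map_congr rfl fun g hg => by rw [hTd g hg]]
      simp
    have hfree : ¬ ∃ U ≤ T.sum ::ₘ R, IsTinyZS U := by
      refine fun h => hS (exists_isTinyZS_of_replace hT0 ?_ h)
      rw [crossNum_eq_of_forall_addOrderOf hTd, mul_one_div,
        div_le_div_iff₀ (by exact_mod_cast hd0) (by exact_mod_cast hs0), one_mul]
      have : Multiset.card T * addOrderOf T.sum ≤ d := calc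
        _ ≤ d.minFac * (d / d.minFac) := Nat.mul_le_mul hTc hsle
        _ = d := Nat.mul_div_cancel' d.minFac_dvd
      exact_mod_cast this
    have hlt : ((T.sum ::ₘ R).map addOrderOf).sum < ((T + R).map addOrderOf).sum := by
      have h1 : (T.map addOrderOf).sum = Multiset.card T * d := hTmap (f := id)
      rw [Multiset.map_cons, Multiset.sum_cons, Multiset.map_add, Multiset.sum_add, h1]
      have h2 : d / d.minFac < d := Nat.div_lt_self hd0 hp.one_lt
      have h3 : d ≤ Multiset.card T * d := Nat.le_mul_of_pos_left d hTpos
      omega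
    refine le_trans ?_ (ih _ hlt _ hfree rfl)
    rw [Nat.cast_le, Multiset.map_cons, Multiset.sum_cons, Multiset.map_add, Multiset.sum_add,
      hTmap]
    refine Nat.add_le_add_right ?_ _
    calc _ ≤ d.minFac * descentWeight n d := Nat.mul_le_mul_right _ hTc
      _ ≤ descentWeight n (d / d.minFac) := minFac_mul_descentWeight_le hn0 hd1
      _ ≤ _ := descentWeight_anti hn0 hsd
  · push Not at hex
    have hmap : (S.map fun g => descentWeight n (addOrderOf g)).sum =
        ((S.map addOrderOf).map (descentWeight n)).sum := by simp
    rw [hmap, Finset.sum_multiset_map_count]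
    have hsub : (S.map addOrderOf).toFinset ⊆ n.divisors := by
      intro d hd
      obtain ⟨g, -, rfl⟩ := Multiset.mem_map.1 (Multiset.mem_toFinset.1 hd)
      exact Nat.mem_divisors.2 ⟨hn ▸ AddMonoid.addOrder_dvd_exponent g, hn0⟩
    rw [Nat.cast_sum, Nat.cast_sum, Finset.mul_sum]
    refine (Finset.sum_le_sum_of_subset_of_nonneg hsub fun _ _ _ => Nat.cast_nonneg _).trans
      (Finset.sum_le_sum fun d hd => ?_)
    rw [Multiset.count_map, smul_eq_mul, Nat.cast_mul, Nat.cast_mul, ← mul_assoc]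
    refine mul_le_mul_of_nonneg_right ?_ (Nat.cast_nonneg _)
    rcases eq_or_ne d 1 with rfl | hd1
    · have : S.filter (fun g => 1 = addOrderOf g) = 0 := by
        refine Multiset.filter_eq_nil.2 fun g hg h => zero_notMem_of_free hS ?_
        rwa [← AddMonoid.addOrderOf_eq_one_iff.1 h.symm]
      simp [this]
    · have h1 := hex d hd1 (Nat.dvd_of_mem_divisors hd)
      have hp := Nat.minFac_prime hd1
      have h2 := hc d.minFac hp.pos
      rw [Nat.cast_sub hp.one_le, Nat.cast_one]
      have h3 : (Multiset.card (S.filter fun g => d = addOrderOf g) : ℝ) + 1 ≤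
          etaC (Fin r → ZMod d.minFac) := by exact_mod_cast h1
      linarith

end Replacement

/-- If `η(C_m^r) ≤ c(m-1)+1` for all `m ≥ 1`, then every finite abelian group `G` of
rank `r` and exponent `n` satisfies `t(G) ≤ 2c(n-1) + 1`. -/
theorem stmt14 (r : ℕ) (hr : 0 < r) (c : ℝ) (hc0 : 0 < c)
    (hc : ∀ m : ℕ, 0 < m → (etaC (Fin r → ZMod m) : ℝ) ≤ c * ((m : ℝ) - 1) + 1)
    (G : Type*) [AddCommGroup G] [Fintype G] (hG : HasRank G r)
    (n : ℕ) (hn : AddMonoid.exponent G = n) :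
    (tC G : ℝ) ≤ 2 * c * ((n : ℝ) - 1) + 1 := by
  classical
  have hn0 : 0 < n := hn ▸ Nat.pos_of_ne_zero AddMonoid.exponent_ne_zero_of_finite
  have hn1 : (1 : ℝ) ≤ n := by exact_mod_cast hn0
  have hB : 0 ≤ 2 * c * ((n : ℝ) - 1) := by
    have : 0 ≤ (n : ℝ) - 1 := by linarith
    positivity
  have key : tC G ≤ ⌊2 * c * ((n : ℝ) - 1)⌋₊ + 1 := by
    refine Nat.sInf_le ⟨Nat.succ_pos _, fun S hS => ?_⟩
    by_contra hfree
    have h1 := sum_descentWeight_le_of_free hG hc hn S hfree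
    have h2 : Multiset.card S ≤ (S.map fun g => descentWeight n (addOrderOf g)).sum := by
      have := Multiset.card_nsmul_le_sum (s := S.map fun g => descentWeight n (addOrderOf g))
        (a := 1) (by
          intro x hx
          obtain ⟨g, -, rfl⟩ := Multiset.mem_map.1 hx
          exact one_le_descentWeight hn0.ne' (hn ▸ AddMonoid.addOrder_dvd_exponent g))
      simpa using this
    have h3 : ((∑ d ∈ n.divisors, (d.minFac - 1) * descentWeight n d : ℕ) : ℝ)
        ≤ 2 * ((n : ℝ) - 1) := by
      have := sum_minFac_sub_one_mul_descentWeight_le n hn0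
      calc _ ≤ ((2 * (n - 1) : ℕ) : ℝ) := by exact_mod_cast this
        _ = _ := by push_cast [Nat.cast_sub hn0]; ring
    have h4 := (Nat.floor_lt hB).1 (Nat.lt_of_succ_le hS)
    have h5 := mul_le_mul_of_nonneg_left h3 hc0.le
    have h6 : (Multiset.card S : ℝ) ≤
        ((S.map fun g => descentWeight n (addOrderOf g)).sum : ℕ) := by exact_mod_cast h2
    linarith
  calc (tC G : ℝ) ≤ ((⌊2 * c * ((n : ℝ) - 1)⌋₊ + 1 : ℕ) : ℝ) := by exact_mod_cast key
    _ ≤ _ := by push_cast; linarith [Nat.floor_le hB]
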